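/- arXiv:2110.13755 — 3 statements merged into one kernel-verified Lean document; each statement's English description precedes it below -/
import Mathlib

section
/- Fix t > 0. Assume 𝒟ᵗ is lower semicontinuous in the Hausdorff sense at x̄, and that there is a neighborhood of x̄ on which 𝒟ᵗ(x) is nonempty and the set {F(x, y) : (y, u) ∈ 𝒟ᵗ(x)} is bounded above. Then ψ_pᵗ is lower semicontinuous at x̄: liminf_{x → x̄} ψ_pᵗ(x) ≥ ψ_pᵗ(x̄). -/
open Filter Topology Metric Set

noncomputable section

abbrev Euc (n : ℕ) : Type := EuclideanSpace ℝ (Fin n)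

/-- Gradient with respect to the first variable. -/
noncomputable def gradX {n m : ℕ} (h : Euc n × Euc m → ℝ) (x : Euc n) (y : Euc m) : Euc n :=
  gradient (fun x' => h (x', y)) x

/-- Gradient with respect to the second variable. -/
noncomputable def gradY {n m : ℕ} (h : Euc n × Euc m → ℝ) (x : Euc n) (y : Euc m) : Euc m :=
  gradient (fun y' => h (x, y')) y

/-- `ℒ(x,y,u)`: gradient w.r.t. `y` of the lower-level Lagrangian. -/
noncomputable def lagGrad {n m q : ℕ} (f : Euc n × Euc m → ℝ) (g : Fin q → Euc n × Euc m → ℝ)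
    (x : Euc n) (y : Euc m) (u : Euc q) : Euc m :=
  gradY (fun p => f p + ∑ i, u i * g i p) x y

/-- The KKT set-valued map `𝒟(x)`. -/
def DSet {n m q : ℕ} (f : Euc n × Euc m → ℝ) (g : Fin q → Euc n × Euc m → ℝ) (x : Euc n) :
    Set (Euc m × Euc q) :=
  {p | lagGrad f g x p.1 p.2 = 0 ∧
    ∀ i, 0 ≤ p.2 i ∧ g i (x, p.1) ≤ 0 ∧ p.2 i * g i (x, p.1) = 0}

/-- The Scholtes relaxation `𝒟ᵗ(x)`. -/
def DtSet {n m q : ℕ} (f : Euc n × Euc m → ℝ) (g : Fin q → Euc n × Euc m → ℝ) (t : ℝ)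
    (x : Euc n) : Set (Euc m × Euc q) :=
  {p | lagGrad f g x p.1 p.2 = 0 ∧
    ∀ i, 0 ≤ p.2 i ∧ g i (x, p.1) ≤ 0 ∧ -(p.2 i * g i (x, p.1)) ≤ t}

/-- `ψ_p(x)`. -/
noncomputable def psiP {n m q : ℕ} (F f : Euc n × Euc m → ℝ) (g : Fin q → Euc n × Euc m → ℝ)
    (x : Euc n) : ℝ :=
  sSup ((fun p : Euc m × Euc q => F (x, p.1)) '' DSet f g x)

/-- `ψ_pᵗ(x)`. -/
noncomputable def psiPt {n m q : ℕ} (F f : Euc n × Euc m → ℝ) (g : Fin q → Euc n × Euc m → ℝ)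
    (t : ℝ) (x : Euc n) : ℝ :=
  sSup ((fun p : Euc m × Euc q => F (x, p.1)) '' DtSet f g t x)

/-- Maximizer set `S_p(x)`. -/
def SpSet {n m q : ℕ} (F f : Euc n × Euc m → ℝ) (g : Fin q → Euc n × Euc m → ℝ) (x : Euc n) :
    Set (Euc m × Euc q) :=
  {p | p ∈ DSet f g x ∧ ∀ p' ∈ DSet f g x, F (x, p'.1) ≤ F (x, p.1)}

/-- Maximizer set `S_pᵗ(x)`. -/
def SpTSet {n m q : ℕ} (F f : Euc n × Euc m → ℝ) (g : Fin q → Euc n × Euc m → ℝ) (t : ℝ)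
    (x : Euc n) : Set (Euc m × Euc q) :=
  {p | p ∈ DtSet f g t x ∧ ∀ p' ∈ DtSet f g t x, F (x, p'.1) ≤ F (x, p.1)}

/-- Upper-level feasible set `X`. -/
def upperX {n p : ℕ} (G : Fin p → Euc n → ℝ) : Set (Euc n) := {x | ∀ j, G j x ≤ 0}

/-- Upper-level regularity (MFCQ for the upper-level constraints). -/
def UpperLevelRegular {n p : ℕ} (G : Fin p → Euc n → ℝ) (x : Euc n) : Prop :=
  ∀ α : Fin p → ℝ, (∀ j, 0 ≤ α j) → (∀ j, α j * G j x = 0) →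
    (∑ j, α j • gradient (G j) x) = 0 → α = 0

/-- `∇_xℒ_l(x,y,u)`. -/
noncomputable def gradXL {n m q : ℕ} (f : Euc n × Euc m → ℝ) (g : Fin q → Euc n × Euc m → ℝ)
    (x : Euc n) (y : Euc m) (u : Euc q) (l : Fin m) : Euc n :=
  gradX (fun p => lagGrad f g p.1 p.2 u l) x y

/-- `∇_yℒ_l(x,y,u)`. -/
noncomputable def gradYL {n m q : ℕ} (f : Euc n × Euc m → ℝ) (g : Fin q → Euc n × Euc m → ℝ)
    (x : Euc n) (y : Euc m) (u : Euc q) (l : Fin m) : Euc m :=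
  gradY (fun p => lagGrad f g p.1 p.2 u l) x y

/-- The M-multiplier set `Λᵉᵐ(x,y,u,v)`. -/
def LambdaEM {n m q : ℕ} (f : Euc n × Euc m → ℝ) (g : Fin q → Euc n × Euc m → ℝ)
    (x : Euc n) (y : Euc m) (u : Euc q) (v : Euc n × Euc m) :
    Set ((Fin m → ℝ) × (Fin q → ℝ)) :=
  {bg | v + (∑ l, bg.1 l • (gradXL f g x y u l, gradYL f g x y u l))
        + (∑ i, bg.2 i • (gradX (g i) x y, gradY (g i) x y)) = 0 ∧
    (∀ i, 0 < u i ∧ g i (x, y) = 0 → (∑ l, bg.1 l * gradY (g i) x y l) = 0) ∧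
    (∀ i, u i = 0 ∧ g i (x, y) < 0 → bg.2 i = 0) ∧
    (∀ i, u i = 0 ∧ g i (x, y) = 0 →
      (0 < bg.2 i ∧ 0 < ∑ l, bg.1 l * gradY (g i) x y l) ∨
        bg.2 i * (∑ l, bg.1 l * gradY (g i) x y l) = 0)}

/-- The M-multiplier set `Λ_yᵉᵐ(x,y,u,w)`. -/
def LambdaYEM {n m q : ℕ} (f : Euc n × Euc m → ℝ) (g : Fin q → Euc n × Euc m → ℝ)
    (x : Euc n) (y : Euc m) (u : Euc q) (w : Euc m) :
    Set ((Fin m → ℝ) × (Fin q → ℝ)) :=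
  {bg | w + (∑ l, bg.1 l • gradYL f g x y u l) + (∑ i, bg.2 i • gradY (g i) x y) = 0 ∧
    (∀ i, 0 < u i ∧ g i (x, y) = 0 → (∑ l, bg.1 l * gradY (g i) x y l) = 0) ∧
    (∀ i, u i = 0 ∧ g i (x, y) < 0 → bg.2 i = 0) ∧
    (∀ i, u i = 0 ∧ g i (x, y) = 0 →
      (0 < bg.2 i ∧ 0 < ∑ l, bg.1 l * gradY (g i) x y l) ∨
        bg.2 i * (∑ l, bg.1 l * gradY (g i) x y l) = 0)}

/-- Condition `(A₁ᵐ)`. -/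
def A1m {n m q : ℕ} (f : Euc n × Euc m → ℝ) (g : Fin q → Euc n × Euc m → ℝ)
    (x : Euc n) (y : Euc m) (u : Euc q) : Prop :=
  ∀ bg ∈ LambdaEM f g x y u 0, bg.1 = 0 ∧ bg.2 = 0

/-- Condition `(A₂ᵐ)`. -/
def A2m {n m q : ℕ} (f : Euc n × Euc m → ℝ) (g : Fin q → Euc n × Euc m → ℝ)
    (x : Euc n) (y : Euc m) (u : Euc q) : Prop :=
  ∀ bg ∈ LambdaYEM f g x y u 0,
    (∑ l, bg.1 l • gradXL f g x y u l) + (∑ i, bg.2 i • gradX (g i) x y) = 0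

/-- The C-multiplier set `Λᵉᶜ(x,y,u,v)`. -/
def LambdaEC {n m q : ℕ} (f : Euc n × Euc m → ℝ) (g : Fin q → Euc n × Euc m → ℝ)
    (x : Euc n) (y : Euc m) (u : Euc q) (v : Euc n × Euc m) :
    Set ((Fin m → ℝ) × (Fin q → ℝ)) :=
  {bg | v + (∑ l, bg.1 l • (gradXL f g x y u l, gradYL f g x y u l))
        + (∑ i, bg.2 i • (gradX (g i) x y, gradY (g i) x y)) = 0 ∧
    (∀ i, 0 < u i ∧ g i (x, y) = 0 → (∑ l, bg.1 l * gradY (g i) x y l) = 0) ∧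
    (∀ i, u i = 0 ∧ g i (x, y) < 0 → bg.2 i = 0) ∧
    (∀ i, u i = 0 ∧ g i (x, y) = 0 →
      0 ≤ bg.2 i * (∑ l, bg.1 l * gradY (g i) x y l))}

/-- The C-multiplier set `Λ_yᵉᶜ(x,y,u,w)`. -/
def LambdaYEC {n m q : ℕ} (f : Euc n × Euc m → ℝ) (g : Fin q → Euc n × Euc m → ℝ)
    (x : Euc n) (y : Euc m) (u : Euc q) (w : Euc m) :
    Set ((Fin m → ℝ) × (Fin q → ℝ)) :=
  {bg | w + (∑ l, bg.1 l • gradYL f g x y u l) + (∑ i, bg.2 i • gradY (g i) x y) = 0 ∧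
    (∀ i, 0 < u i ∧ g i (x, y) = 0 → (∑ l, bg.1 l * gradY (g i) x y l) = 0) ∧
    (∀ i, u i = 0 ∧ g i (x, y) < 0 → bg.2 i = 0) ∧
    (∀ i, u i = 0 ∧ g i (x, y) = 0 →
      0 ≤ bg.2 i * (∑ l, bg.1 l * gradY (g i) x y l))}

/-- Condition `(A₁ᶜ)`. -/
def A1c {n m q : ℕ} (f : Euc n × Euc m → ℝ) (g : Fin q → Euc n × Euc m → ℝ)
    (x : Euc n) (y : Euc m) (u : Euc q) : Prop :=
  ∀ bg ∈ LambdaEC f g x y u 0, bg.1 = 0 ∧ bg.2 = 0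

/-- Condition `(A₂ᶜ)`. -/
def A2c {n m q : ℕ} (f : Euc n × Euc m → ℝ) (g : Fin q → Euc n × Euc m → ℝ)
    (x : Euc n) (y : Euc m) (u : Euc q) : Prop :=
  ∀ bg ∈ LambdaYEC f g x y u 0,
    (∑ l, bg.1 l • gradXL f g x y u l) + (∑ i, bg.2 i • gradX (g i) x y) = 0

/-- The C-stationarity conditions at `x` with witness `(y,u)` and multipliers `(α,β,γ)`. -/
def CStationaryWith {n m p q : ℕ} (F f : Euc n × Euc m → ℝ) (g : Fin q → Euc n × Euc m → ℝ)
    (G : Fin p → Euc n → ℝ) (x : Euc n) (y : Euc m) (u : Euc q)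
    (α : Fin p → ℝ) (β : Fin m → ℝ) (γ : Fin q → ℝ) : Prop :=
  gradX F x y + (∑ j, α j • gradient (G j) x) + (∑ l, β l • gradXL f g x y u l)
      + (∑ i, γ i • gradX (g i) x y) = 0 ∧
  gradY F x y + (∑ l, β l • gradYL f g x y u l) + (∑ i, γ i • gradY (g i) x y) = 0 ∧
  (∀ j, 0 ≤ α j ∧ G j x ≤ 0 ∧ α j * G j x = 0) ∧
  (∀ i, 0 < u i ∧ g i (x, y) = 0 → (∑ l, β l * gradY (g i) x y l) = 0) ∧
  (∀ i, u i = 0 ∧ g i (x, y) < 0 → γ i = 0) ∧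
  (∀ i, u i = 0 ∧ g i (x, y) = 0 → 0 ≤ γ i * (∑ l, β l * gradY (g i) x y l))

/-- `x` is a C-stationary point. -/
def CStationary {n m p q : ℕ} (F f : Euc n × Euc m → ℝ) (g : Fin q → Euc n × Euc m → ℝ)
    (G : Fin p → Euc n → ℝ) (x : Euc n) : Prop :=
  ∃ y u, (y, u) ∈ SpSet F f g x ∧ ∃ α β γ, CStationaryWith F f g G x y u α β γ

/-- The stationarity system for the relaxed problem with parameter `t`. -/
def RelaxedStationary {n m p q : ℕ} (F f : Euc n × Euc m → ℝ) (g : Fin q → Euc n × Euc m → ℝ)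
    (G : Fin p → Euc n → ℝ) (t : ℝ) (x : Euc n) (y : Euc m) (u : Euc q)
    (α : Fin p → ℝ) (β : Fin m → ℝ) (γ μ δ : Fin q → ℝ) : Prop :=
  (y, u) ∈ SpTSet F f g t x ∧
  gradX F x y + (∑ j, α j • gradient (G j) x) - (∑ l, β l • gradXL f g x y u l)
      - (∑ i, (γ i - δ i * u i) • gradX (g i) x y) = 0 ∧
  gradY F x y - (∑ l, β l • gradYL f g x y u l)
      - (∑ i, (γ i - δ i * u i) • gradY (g i) x y) = 0 ∧
  (∀ i, -(∑ l, β l * gradY (g i) x y l) + μ i + δ i * g i (x, y) = 0) ∧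
  (∀ j, 0 ≤ α j ∧ G j x ≤ 0 ∧ α j * G j x = 0) ∧
  (∀ i, 0 ≤ γ i ∧ g i (x, y) ≤ 0 ∧ γ i * g i (x, y) = 0) ∧
  (∀ i, 0 ≤ μ i ∧ 0 ≤ u i ∧ μ i * u i = 0) ∧
  (∀ i, 0 ≤ δ i ∧ -(u i * g i (x, y)) ≤ t ∧ δ i * (u i * g i (x, y) + t) = 0)

/-- Lower-level optimal solution map `S(x)`. -/
def lowerS {n m q : ℕ} (f : Euc n × Euc m → ℝ) (g : Fin q → Euc n × Euc m → ℝ) (x : Euc n) :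
    Set (Euc m) :=
  {y | (∀ i, g i (x, y) ≤ 0) ∧ ∀ y', (∀ i, g i (x, y') ≤ 0) → f (x, y) ≤ f (x, y')}

/-- Pessimistic value function `φ_p(x)`. -/
noncomputable def phiP {n m q : ℕ} (F f : Euc n × Euc m → ℝ)
    (g : Fin q → Euc n × Euc m → ℝ) (x : Euc n) : ℝ :=
  sSup ((fun y => F (x, y)) '' lowerS f g x)


/-- `Ψ` is Lipschitz-like (Aubin continuous) around `(xb, zb)` with modulus `τ`. -/
def LipschitzLike {n m q : ℕ} (Ψ : Euc n → Set (Euc m × Euc q)) (xb : Euc n)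
    (zb : Euc m × Euc q) (τ : ℝ) : Prop :=
  ∃ U ∈ 𝓝 xb, ∃ V ∈ 𝓝 zb, ∀ x ∈ U, ∀ x' ∈ U, ∀ z ∈ Ψ x ∩ V,
    ∃ z' ∈ Ψ x', dist z z' ≤ τ * dist x x'

/-- `Ψ` is inner semicontinuous at the point `(xb, zb)` of its graph. -/
def InnerSemicontinuousAt {α β : Type*} [TopologicalSpace α] [TopologicalSpace β]
    (Ψ : α → Set β) (xb : α) (zb : β) : Prop :=
  ∀ xk : ℕ → α, Tendsto xk atTop (𝓝 xb) →
    ∃ zk : ℕ → β, (∀ k, zk k ∈ Ψ (xk k)) ∧ Tendsto zk atTop (𝓝 zb)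

/-- The supremum over a lower semicontinuous set-valued map of a jointly continuous function is
lower semicontinuous, provided the suprema are finite near the base point. -/
theorem lowerSemicontinuousAt_sSup_image {X Z : Type*} [TopologicalSpace X] [TopologicalSpace Z]
    {Ψ : X → Set Z} {φ : X × Z → ℝ} {x₀ : X} (hφ : Continuous φ) (hne : (Ψ x₀).Nonempty)
    (hbdd : ∀ᶠ x in 𝓝 x₀, BddAbove ((fun z => φ (x, z)) '' Ψ x))
    (hΨ : ∀ z ∈ Ψ x₀, ∀ U ∈ 𝓝 z, ∀ᶠ x in 𝓝 x₀, (Ψ x ∩ U).Nonempty) :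
    LowerSemicontinuousAt (fun x => sSup ((fun z => φ (x, z)) '' Ψ x)) x₀ := by
  intro c hc
  obtain ⟨_, ⟨z, hz, rfl⟩, hcz⟩ := exists_lt_of_lt_csSup (hne.image _) hc
  have hnear : ∀ᶠ p in 𝓝 (x₀, z), c < φ p := hφ.continuousAt.eventually_const_lt hcz
  rw [nhds_prod_eq] at hnear
  obtain ⟨V, hV, U, hU, hVU⟩ := mem_prod_iff.mp hnear
  filter_upwards [hbdd, hV, hΨ z hz U hU] with x hx hxV ⟨z', hz', hzU⟩
  have hlt : c < φ (x, z') := hVU (mk_mem_prod hxV hzU)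
  exact hlt.trans_le (le_csSup hx (mem_image_of_mem _ hz'))

/-- lower semicontinuity of `ψ_pᵗ` at `xb` from Hausdorff lower
semicontinuity of `𝒟ᵗ` at `xb`. -/
theorem stmt_15 {n m q : ℕ} (hn : 0 < n) (hm : 0 < m) (hq : 0 < q)
    (F f : Euc n × Euc m → ℝ) (g : Fin q → Euc n × Euc m → ℝ)
    (hf : ContDiff ℝ 1 f) (hg : ∀ i, ContDiff ℝ 1 (g i)) (hF : ContDiff ℝ 1 F)
    (t : ℝ) (ht : 0 < t) (xb : Euc n)
    (hlsc : ∀ ε > 0, ∃ δ > 0, ∀ x : Euc n, dist x xb < δ →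
      ∀ z ∈ DtSet f g t xb, ∃ z' ∈ DtSet f g t x, dist z z' ≤ ε)
    (hnbd : ∀ᶠ x in 𝓝 xb, (DtSet f g t x).Nonempty ∧
      BddAbove ((fun z : Euc m × Euc q => F (x, z.1)) '' DtSet f g t x)) :
    LowerSemicontinuousAt (psiPt F f g t) xb := by
  refine lowerSemicontinuousAt_sSup_image (φ := fun p : Euc n × (Euc m × Euc q) => F (p.1, p.2.1))
    (hF.continuous.comp (by fun_prop)) hnbd.self_of_nhds.1 (hnbd.mono fun _ h => h.2) ?_
  intro z hz U hU
  obtain ⟨ε, hε, hεU⟩ := Metric.nhds_basis_closedBall.mem_iff.mp hU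
  obtain ⟨δ, hδ, h⟩ := hlsc ε hε
  filter_upwards [Metric.ball_mem_nhds xb hδ] with x hx
  obtain ⟨z', hz', hd⟩ := h x hx z hz
  exact ⟨z', hz', hεU (Metric.mem_closedBall'.mpr hd)⟩

end
end

section
/- Suppose the lower-level problem is convex (for every x, the functions y ↦ f(x, y) and y ↦ g_i(x, y), i = 1, …, q, are convex), the Slater condition holds (for every x ∈ X there exists y with g_i(x, y) < 0 for all i), and S(x) ≠ ∅ for all x ∈ X. Let x̄ ∈ X be a local optimal solution of the pessimistic bilevel problem that is upper-level regular, let (ȳ, ū) ∈ S_p(x̄) be such that S_p is inner semicontinuous at (x̄, (ȳ, ū)), and assume conditions (A₁ᶜ) and (A₂ᶜ) hold at (x̄, ȳ, ū). Then there exist (α, β, γ) ∈ ℝᵖ × ℝᵐ × ℝ^q such that: ∇_xF(x̄,ȳ) + ∑_j α_j ∇G_j(x̄) + ∑_l β_l ∇_xℒ_l(x̄,ȳ,ū) + ∑_i γ_i ∇_x g_i(x̄,ȳ) = 0; ∇_yF(x̄,ȳ) + ∑_l β_l ∇_yℒ_l(x̄,ȳ,ū) + ∑_i γ_i ∇_y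 g_i(x̄,ȳ) = 0; α ≥ 0, G(x̄) ≤ 0 and α_j G_j(x̄) = 0 for all j; ⟨β, ∇_y g_i(x̄,ȳ)⟩ = 0 for all i ∈ ν(x̄,ȳ,ū); γ_i = 0 for all i ∈ η(x̄,ȳ,ū); and γ_i⟨β, ∇_y g_i(x̄,ȳ)⟩ ≥ 0 for all i ∈ θ(x̄,ȳ,ū); i.e. x̄ is C-stationary with witness (ȳ, ū). -/
open Filter Topology Metric Set

noncomputable section

open scoped InnerProductSpace

theorem ConvexOn.add_fderiv_le {E : Type*} [NormedAddCommGroup E] [NormedSpace ℝ E]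
    {h : E → ℝ} (hh : ConvexOn ℝ univ h) {h' : E →L[ℝ] ℝ} {y : E} (hd : HasFDerivAt h h' y)
    (z : E) : h y + h' (z - y) ≤ h z := by
  have hline : HasDerivAt (fun t : ℝ => h (AffineMap.lineMap y z t)) (h' (z - y)) 0 := by
    have h1 : HasDerivAt (AffineMap.lineMap y z : ℝ → E) (z - y) 0 :=
      AffineMap.hasDerivAt_lineMap
    have h2 : HasFDerivAt h h' (AffineMap.lineMap y z (0 : ℝ)) := by simpa using hd
    exact h2.comp_hasDerivAt 0 h1
  have hc : ConvexOn ℝ univ (fun t : ℝ => h (AffineMap.lineMap y z t)) :=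
    hh.comp_affineMap (AffineMap.lineMap y z)
  have := hc.le_slope_of_hasDerivWithinAt_Ioi (mem_univ 0) (mem_univ 1) one_pos
    hline.hasDerivWithinAt
  simp [slope_def_field] at this
  rw [map_sub]
  linarith

theorem hasDerivAt_max_zero_sq (s : ℝ) :
    HasDerivAt (fun s : ℝ => max s 0 ^ 2) (2 * max s 0) s := by
  rcases lt_trichotomy s 0 with hs | rfl | hs
  · have : (fun s : ℝ => max s 0 ^ 2) =ᶠ[𝓝 s] fun _ => 0 := by
      filter_upwards [gt_mem_nhds hs] with t ht
      simp [max_eq_right ht.le]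
    rw [max_eq_right hs.le, mul_zero]
    exact (hasDerivAt_const s (0 : ℝ)).congr_of_eventuallyEq this
  · rw [max_self, mul_zero, hasDerivAt_iff_isLittleO_nhds_zero]
    refine Asymptotics.IsBigO.trans_isLittleO (g := fun h : ℝ => h ^ 2) ?_ ?_
    · refine Asymptotics.IsBigO.of_bound 1 (Eventually.of_forall fun t => ?_)
      rcases le_total t 0 with ht | ht <;> simp [ht, sq_nonneg]
    · exact Asymptotics.isLittleO_pow_id one_lt_two
  · have : (fun s : ℝ => max s 0 ^ 2) =ᶠ[𝓝 s] fun s => s ^ 2 := by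
      filter_upwards [lt_mem_nhds hs] with t ht
      simp [max_eq_left ht.le]
    rw [max_eq_left hs.le]
    refine HasDerivAt.congr_of_eventuallyEq ?_ this
    simpa using hasDerivAt_pow 2 s

/-- Minimizers of a penalized function near a strict constrained local minimizer. -/
theorem exists_tendsto_fderiv_penalty_eq_zero {E : Type*} [NormedAddCommGroup E]
    [NormedSpace ℝ E] [ProperSpace E] {Φ P : E → ℝ} {zb : E} (hΦ : Differentiable ℝ Φ)
    (hP : Differentiable ℝ P) (hP0 : ∀ z, 0 ≤ P z) (hPb : P zb = 0)
    (hmin : ∀ᶠ z in 𝓝 zb, P z = 0 → Φ z ≤ Φ zb → z = zb) :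
    ∃ z : ℕ → E, Tendsto z atTop (𝓝 zb) ∧
      ∀ᶠ k : ℕ in atTop, fderiv ℝ Φ (z k) + (k : ℝ) • fderiv ℝ P (z k) = 0 := by
  obtain ⟨r, hr, hball⟩ := Metric.nhds_basis_closedBall.eventually_iff.1 hmin
  have hK : IsCompact (closedBall zb r) := isCompact_closedBall zb r
  have hzb : zb ∈ closedBall zb r := mem_closedBall_self hr.le
  have hex : ∀ k : ℕ, ∃ z ∈ closedBall zb r,
      IsMinOn (fun z => Φ z + k * P z) (closedBall zb r) z := fun k =>
    hK.exists_isMinOn ⟨zb, hzb⟩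
      (hΦ.continuous.add (continuous_const.mul hP.continuous)).continuousOn
  choose z hzK hzmin using hex
  obtain ⟨w, -, hw⟩ := hK.exists_isMinOn ⟨zb, hzb⟩ hΦ.continuous.continuousOn
  have hle : ∀ k : ℕ, Φ (z k) + k * P (z k) ≤ Φ zb := fun k => by
    simpa [hPb] using isMinOn_iff.1 (hzmin k) zb hzb
  have hΦle : ∀ k : ℕ, Φ (z k) ≤ Φ zb := fun k => by
    have := mul_nonneg (Nat.cast_nonneg (α := ℝ) k) (hP0 (z k))
    linarith [hle k]
  have hPlim : Tendsto (fun k => P (z k)) atTop (𝓝 0) := by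
    refine tendsto_of_tendsto_of_tendsto_of_le_of_le' tendsto_const_nhds
      (tendsto_const_div_atTop_nhds_zero_nat (Φ zb - Φ w)) (Eventually.of_forall fun k => hP0 _) ?_
    filter_upwards [eventually_gt_atTop 0] with k hk
    rw [le_div_iff₀ (by exact_mod_cast hk)]
    have := isMinOn_iff.1 hw (z k) (hzK k)
    linarith [hle k]
  have hlim : Tendsto z atTop (𝓝 zb) := by
    refine hK.tendsto_nhds_of_unique_mapClusterPt (Eventually.of_forall hzK) fun y hy hcl => ?_
    obtain ⟨φ, hφ, hφy⟩ := hcl.tendsto_subseq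
    refine hball hy ?_ ?_
    · exact tendsto_nhds_unique ((hP.continuous.tendsto y).comp hφy)
        (hPlim.comp hφ.tendsto_atTop)
    · exact le_of_tendsto' ((hΦ.continuous.tendsto y).comp hφy) fun k => hΦle _
  refine ⟨z, hlim, ?_⟩
  filter_upwards [hlim.eventually (ball_mem_nhds zb hr)] with k hk
  have hloc : IsLocalMin (fun z => Φ z + k * P z) (z k) :=
    (hzmin k).isLocalMin (mem_of_superset (isOpen_ball.mem_nhds hk) ball_subset_closedBall)
  have hd : HasFDerivAt (fun z => Φ z + k * P z)
      (fderiv ℝ Φ (z k) + (k : ℝ) • fderiv ℝ P (z k)) (z k) :=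
    (hΦ _).hasFDerivAt.add ((hP _).hasFDerivAt.const_mul _)
  exact hloc.hasFDerivAt_eq_zero hd

/-- A Fritz John rule. The multipliers are limits of positive multiples of the coefficients of
the derivative of the penalty function. -/
theorem exists_fritzJohn_multipliers {E ι : Type*} [Fintype ι] [NormedAddCommGroup E]
    [NormedSpace ℝ E] [ProperSpace E] {Φ P : E → ℝ} {zb : E} {c : ι → E → ℝ}
    {v : ι → E → E →L[ℝ] ℝ} (hΦ : ContDiff ℝ 1 Φ)
    (hP : ∀ z, HasFDerivAt P (∑ i, c i z • v i z) z) (hv : ∀ i, Continuous (v i))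
    (hP0 : ∀ z, 0 ≤ P z) (hPb : P zb = 0)
    (hmin : ∀ᶠ z in 𝓝 zb, P z = 0 → Φ z ≤ Φ zb → z = zb) :
    ∃ (l : Ultrafilter ℕ) (z : ℕ → E) (τ : ℕ → ℝ) (a : ℝ) (cb : ι → ℝ),
      Tendsto z l (𝓝 zb) ∧ (∀ k, 0 ≤ τ k) ∧ 0 ≤ a ∧ (a ≠ 0 ∨ cb ≠ 0) ∧
      (∀ i, Tendsto (fun k => τ k * c i (z k)) l (𝓝 (cb i))) ∧
      a • fderiv ℝ Φ zb + ∑ i, cb i • v i zb = 0 := by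
  obtain ⟨z, hz, hzero⟩ := exists_tendsto_fderiv_penalty_eq_zero (hΦ.differentiable one_ne_zero)
    (fun z => (hP z).differentiableAt) hP0 hPb hmin
  let l : Ultrafilter ℕ := hyperfilter ℕ
  have hl : (l : Filter ℕ) ≤ atTop := Nat.hyperfilter_le_atTop
  let d : ℕ → ι → ℝ := fun k i => k * c i (z k)
  let s : ℕ → ℝ := fun k => (1 + ‖d k‖)⁻¹
  have hpos : ∀ k, 0 < 1 + ‖d k‖ := fun k => by positivity
  have hs : ∀ k, s k ∈ Icc (0 : ℝ) 1 := fun k =>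
    ⟨inv_nonneg.2 (hpos k).le, inv_le_one_of_one_le₀ (by linarith [norm_nonneg (d k)])⟩
  have hnorm : ∀ k, s k + ‖s k • d k‖ = 1 := fun k => by
    rw [norm_smul, Real.norm_of_nonneg (hs k).1, ← mul_one_add]
    exact inv_mul_cancel₀ (hpos k).ne'
  obtain ⟨a, ha, hsa⟩ := isCompact_Icc.ultrafilter_le_nhds (l.map s)
    (tendsto_principal.2 (Eventually.of_forall hs))
  obtain ⟨cb, -, hcb⟩ := (isCompact_closedBall (0 : ι → ℝ) 1).ultrafilter_le_nhds
    (l.map fun k => s k • d k) (by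
      refine tendsto_principal.2 (Eventually.of_forall fun k => ?_)
      rw [mem_closedBall_zero_iff]
      linarith [hnorm k, (hs k).1])
  have hsa' : Tendsto s l (𝓝 a) := hsa
  have hcb' : Tendsto (fun k => s k • d k) l (𝓝 cb) := hcb
  have hzl : Tendsto z l (𝓝 zb) := hz.mono_left hl
  refine ⟨l, z, fun k => s k * k, a, cb, hzl, fun k => mul_nonneg (hs k).1 k.cast_nonneg,
    ha.1, ?_, fun i => ?_, ?_⟩
  · by_contra! h
    have h1 : a + ‖cb‖ = 1 := tendsto_nhds_unique (hsa'.add hcb'.norm)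
      (by simp only [hnorm]; exact tendsto_const_nhds)
    simp [h.1, h.2] at h1
  · refine (tendsto_pi_nhds.1 hcb' i).congr fun k => ?_
    simp [d, mul_assoc]
  · have h1 : Tendsto (fun k => s k • fderiv ℝ Φ (z k) + ∑ i, (s k • d k) i • v i (z k)) l
        (𝓝 (a • fderiv ℝ Φ zb + ∑ i, cb i • v i zb)) :=
      (hsa'.smul (((hΦ.continuous_fderiv one_ne_zero).tendsto zb).comp hzl)).add
        (tendsto_finsetSum _ fun i _ =>
          (tendsto_pi_nhds.1 hcb' i).smul (((hv i).tendsto zb).comp hzl))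
    refine tendsto_nhds_unique h1 (tendsto_const_nhds.congr' ?_)
    filter_upwards [hl hzero] with k hk
    rw [(hP (z k)).fderiv] at hk
    rw [← smul_zero (s k), ← hk, smul_add, Finset.smul_sum, Finset.smul_sum]
    simp [d, smul_smul]

/-- A difference quotient along sequences converging to a point of strict differentiability. -/
theorem HasStrictFDerivAt.tendsto_smul_sub {E V ι : Type*} [NormedAddCommGroup E]
    [NormedSpace ℝ E] [NormedAddCommGroup V] [NormedSpace ℝ V] {h : E → V} {h' : E →L[ℝ] V}
    {e w : E} (hh : HasStrictFDerivAt h h' e) {l : Filter ι} {a b : ι → E} {t : ι → ℝ}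
    (ha : Tendsto a l (𝓝 e)) (hb : Tendsto b l (𝓝 e))
    (hw : Tendsto (fun k => t k • (a k - b k)) l (𝓝 w)) :
    Tendsto (fun k => t k • (h (a k) - h (b k))) l (𝓝 (h' w)) := by
  have ho := hh.isLittleO.comp_tendsto (ha.prodMk_nhds hb)
  have h1 : Tendsto (fun k => t k • (h (a k) - h (b k) - h' (a k - b k))) l (𝓝 0) := by
    rw [← Asymptotics.isLittleO_one_iff ℝ]
    exact ((Asymptotics.isBigO_refl t l).smul_isLittleO ho).trans_isBigO (hw.isBigO_one ℝ)
  have h2 := h1.add ((h'.continuous.tendsto w).comp hw)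
  rw [zero_add] at h2
  refine h2.congr fun k => ?_
  simp [smul_sub]

theorem inner_gradX_add_inner_gradY {n m : ℕ} {h : Euc n × Euc m → ℝ} {x : Euc n} {y : Euc m}
    (hh : DifferentiableAt ℝ h (x, y)) (dx : Euc n) (dy : Euc m) :
    ⟪gradX h x y, dx⟫_ℝ + ⟪gradY h x y, dy⟫_ℝ = fderiv ℝ h (x, y) (dx, dy) := by
  have h1 : HasFDerivAt (fun x' => h (x', y))
      ((fderiv ℝ h (x, y)).comp (ContinuousLinearMap.inl ℝ (Euc n) (Euc m))) x :=
    hh.hasFDerivAt.comp x (hasFDerivAt_prodMk_left x y)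
  have h2 : HasFDerivAt (fun y' => h (x, y'))
      ((fderiv ℝ h (x, y)).comp (ContinuousLinearMap.inr ℝ (Euc n) (Euc m))) y :=
    hh.hasFDerivAt.comp y (hasFDerivAt_prodMk_right x y)
  rw [gradX, gradY, inner_gradient_left, inner_gradient_left, h1.fderiv, h2.fderiv]
  simp [← map_add]

theorem inner_gradY {n m : ℕ} {h : Euc n × Euc m → ℝ} {x : Euc n} {y : Euc m}
    (hh : DifferentiableAt ℝ h (x, y)) (dy : Euc m) :
    ⟪gradY h x y, dy⟫_ℝ = fderiv ℝ h (x, y) (0, dy) := by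
  simp [← inner_gradX_add_inner_gradY hh]

theorem gradY_apply {n m : ℕ} {h : Euc n × Euc m → ℝ} {x : Euc n} {y : Euc m}
    (hh : DifferentiableAt ℝ h (x, y)) (l : Fin m) :
    gradY h x y l = fderiv ℝ h (x, y) (0, EuclideanSpace.single l 1) := by
  simp [← inner_gradY hh, EuclideanSpace.inner_single_right]

theorem lagGrad_apply {n m q : ℕ} {f : Euc n × Euc m → ℝ} {g : Fin q → Euc n × Euc m → ℝ}
    (hf : Differentiable ℝ f) (hg : ∀ i, Differentiable ℝ (g i)) (x : Euc n) (y : Euc m)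
    (u : Euc q) (l : Fin m) :
    lagGrad f g x y u l = gradY f x y l + ∑ i, u i * gradY (g i) x y l := by
  have hd : HasFDerivAt (fun p => f p + ∑ i, u i * g i p)
      (fderiv ℝ f (x, y) + ∑ i, u i • fderiv ℝ (g i) (x, y)) (x, y) :=
    (hf _).hasFDerivAt.add (HasFDerivAt.fun_sum fun i _ => (hg i _).hasFDerivAt.const_mul (u i))
  rw [lagGrad, gradY_apply hd.differentiableAt, hd.fderiv]
  simp [gradY_apply (hf _), gradY_apply (hg _ _)]

theorem contDiff_lagGrad {n m q : ℕ} {f : Euc n × Euc m → ℝ} {g : Fin q → Euc n × Euc m → ℝ}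
    (hf : ContDiff ℝ 2 f) (hg : ∀ i, ContDiff ℝ 2 (g i)) (l : Fin m) :
    ContDiff ℝ 1 (fun z : Euc n × Euc m × Euc q => lagGrad f g z.1 z.2.1 z.2.2 l) := by
  have key : ∀ h : Euc n × Euc m → ℝ, ContDiff ℝ 2 h →
      ContDiff ℝ 1 (fun z : Euc n × Euc m × Euc q => gradY h z.1 z.2.1 l) := fun h hh => by
    have h0 : ContDiff ℝ 1 (fderiv ℝ h) := hh.fderiv_right (by norm_num)
    simp only [gradY_apply (hh.differentiable two_ne_zero _)]
    have h1 : ContDiff ℝ 1 (fun z : Euc n × Euc m × Euc q => (z.1, z.2.1)) := by fun_prop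
    exact (h0.comp h1).clm_apply contDiff_const
  have hu : ∀ i, ContDiff ℝ 1 (fun z : Euc n × Euc m × Euc q => z.2.2 i) := fun i => by
    fun_prop
  simp only [lagGrad_apply (hf.differentiable two_ne_zero)
    (fun i => (hg i).differentiable two_ne_zero)]
  exact (key f hf).add (ContDiff.sum fun i _ => (hu i).mul (key (g i) (hg i)))

theorem fderiv_lagGrad_apply {n m q : ℕ} {f : Euc n × Euc m → ℝ}
    {g : Fin q → Euc n × Euc m → ℝ} (hf : ContDiff ℝ 2 f) (hg : ∀ i, ContDiff ℝ 2 (g i))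
    (l : Fin m) (x : Euc n) (y : Euc m) (u : Euc q) (dx : Euc n) (dy : Euc m) (du : Euc q) :
    fderiv ℝ (fun z : Euc n × Euc m × Euc q => lagGrad f g z.1 z.2.1 z.2.2 l) (x, y, u)
      (dx, dy, du) =
      ⟪gradXL f g x y u l, dx⟫_ℝ + ⟪gradYL f g x y u l, dy⟫_ℝ +
        ∑ i, du i * gradY (g i) x y l := by
  have hd := ((contDiff_lagGrad hf hg l).differentiable one_ne_zero (x, y, u)).hasFDerivAt
  have h1 : HasFDerivAt (fun p : Euc n × Euc m => (p.1, p.2, u))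
      ((ContinuousLinearMap.fst ℝ (Euc n) (Euc m)).prod
        ((ContinuousLinearMap.snd ℝ (Euc n) (Euc m)).prod 0)) (x, y) :=
    hasFDerivAt_fst.prodMk (hasFDerivAt_snd.prodMk (hasFDerivAt_const u (x, y)))
  have hxy := HasFDerivAt.comp (x, y) (f := fun p : Euc n × Euc m => (p.1, p.2, u)) hd h1
  have h2 : HasFDerivAt (fun v : Euc q => (x, y, v))
      ((0 : Euc q →L[ℝ] Euc n).prod
        ((0 : Euc q →L[ℝ] Euc m).prod (ContinuousLinearMap.id ℝ (Euc q)))) u :=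
    (hasFDerivAt_const x u).prodMk ((hasFDerivAt_const y u).prodMk (hasFDerivAt_id u))
  have hu := HasFDerivAt.comp u (f := fun v : Euc q => (x, y, v)) hd h2
  have hu' : HasFDerivAt (fun v : Euc q => lagGrad f g x y v l)
      (∑ i, gradY (g i) x y l • (EuclideanSpace.proj i : Euc q →L[ℝ] ℝ)) u := by
    simp only [lagGrad_apply (hf.differentiable two_ne_zero)
      (fun i => (hg i).differentiable two_ne_zero)]
    exact (HasFDerivAt.fun_sum fun i _ => ((EuclideanSpace.proj i :
      Euc q →L[ℝ] ℝ).hasFDerivAt).mul_const (gradY (g i) x y l)).const_add (gradY f x y l)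
  have e1 : ⟪gradXL f g x y u l, dx⟫_ℝ + ⟪gradYL f g x y u l, dy⟫_ℝ =
      fderiv ℝ (fun z : Euc n × Euc m × Euc q => lagGrad f g z.1 z.2.1 z.2.2 l) (x, y, u)
        (dx, dy, 0) :=
    (inner_gradX_add_inner_gradY hxy.differentiableAt dx dy).trans
      (congrArg (fun A => A (dx, dy)) hxy.fderiv)
  have e2 : fderiv ℝ (fun z : Euc n × Euc m × Euc q => lagGrad f g z.1 z.2.1 z.2.2 l) (x, y, u)
      (0, 0, du) = ∑ i, du i * gradY (g i) x y l := by
    simpa [mul_comm] using congrArg (fun A => A du) (hu.unique hu')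
  rw [e1, ← e2, ← map_add]
  simp

theorem gradYL_symm {n m q : ℕ} {f : Euc n × Euc m → ℝ} {g : Fin q → Euc n × Euc m → ℝ}
    (hf : ContDiff ℝ 2 f) (hg : ∀ i, ContDiff ℝ 2 (g i)) (x : Euc n) (y : Euc m) (u : Euc q)
    (k l : Fin m) : gradYL f g x y u l k = gradYL f g x y u k l := by
  let H : Euc n × Euc m → ℝ := fun p => f p + ∑ i, u i * g i p
  have hH : ContDiff ℝ 2 H := hf.add (ContDiff.sum fun i _ => contDiff_const.mul (hg i))
  have hH' : Differentiable ℝ (fderiv ℝ H) :=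
    (hH.fderiv_right (m := 1) (by norm_num)).differentiable one_ne_zero
  have key : ∀ k l, gradYL f g x y u l k = fderiv ℝ (fderiv ℝ H) (x, y)
      (0, EuclideanSpace.single k 1) (0, EuclideanSpace.single l 1) := fun k l => by
    have e : (fun p : Euc n × Euc m => lagGrad f g p.1 p.2 u l) =
        fun p => fderiv ℝ H p (0, EuclideanSpace.single l 1) :=
      funext fun p => gradY_apply (hH.differentiable two_ne_zero (p.1, p.2)) l
    have hd := (hH' (x, y)).hasFDerivAt.clm_apply
      (hasFDerivAt_const ((0, EuclideanSpace.single l 1) : Euc n × Euc m) (x, y))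
    rw [gradYL, e, gradY_apply hd.differentiableAt, hd.fderiv]
    simp
  rw [key, key]
  exact hH.contDiffAt.isSymmSndFDerivAt (by simp) _ _

theorem two_mul_max_complementarity_nonneg (s t : ℝ) :
    0 ≤ (2 * max s 0 * max t 0 ^ 2 - 2 * max (-s) 0) *
      (2 * max t 0 * max s 0 ^ 2 - 2 * max (-t) 0) := by
  rcases le_total s 0 with hs | hs <;> rcases le_total t 0 with ht | ht <;>
    simp [hs, ht]
  · nlinarith [mul_nonneg_of_nonpos_of_nonpos hs ht]
  · positivity

theorem mul_max_complementarity_eq {s t : ℝ} (ht : 0 < t) :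
    t * (2 * max t 0 * max s 0 ^ 2 - 2 * max (-t) 0) =
      max s 0 * (2 * max s 0 * max t 0 ^ 2 - 2 * max (-s) 0) := by
  rcases le_total s 0 with hs | hs <;> simp [hs, ht.le]
  ring

/-- Fritz John type C-stationarity for a mathematical program with inequality constraints `A`,
equality constraints `B` and complementarity constraints `0 ≤ a ⟂ b ≥ 0`. -/
theorem exists_fritzJohn_complementarity {E ι κ μ : Type*} [Fintype ι] [Fintype κ] [Fintype μ]
    [NormedAddCommGroup E] [NormedSpace ℝ E] [ProperSpace E] {Φ : E → ℝ} {A : ι → E → ℝ}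
    {B : κ → E → ℝ} {a b : μ → E → ℝ} {zb : E} (hΦ : ContDiff ℝ 1 Φ)
    (hA : ∀ j, ContDiff ℝ 1 (A j)) (hB : ∀ l, ContDiff ℝ 1 (B l))
    (ha : ∀ i, ContDiff ℝ 1 (a i)) (hb : ∀ i, ContDiff ℝ 1 (b i))
    (hAb : ∀ j, A j zb ≤ 0) (hBb : ∀ l, B l zb = 0)
    (habb : ∀ i, 0 ≤ a i zb ∧ 0 ≤ b i zb ∧ a i zb * b i zb = 0)
    (hmin : ∀ᶠ z in 𝓝 zb, (∀ j, A j z ≤ 0) → (∀ l, B l z = 0) →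
      (∀ i, 0 ≤ a i z ∧ 0 ≤ b i z ∧ a i z * b i z = 0) → Φ z ≤ Φ zb → z = zb) :
    ∃ (t : ℝ) (α : ι → ℝ) (β : κ → ℝ) (σ δ : μ → ℝ),
      0 ≤ t ∧ ¬(t = 0 ∧ α = 0 ∧ β = 0 ∧ σ = 0 ∧ δ = 0) ∧
      (∀ j, 0 ≤ α j ∧ α j * A j zb = 0) ∧
      (∀ i, 0 < a i zb → σ i = 0) ∧ (∀ i, 0 < b i zb → δ i = 0) ∧ (∀ i, 0 ≤ σ i * δ i) ∧
      t • fderiv ℝ Φ zb + ∑ j, α j • fderiv ℝ (A j) zb + ∑ l, β l • fderiv ℝ (B l) zb +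
        ∑ i, σ i • fderiv ℝ (a i) zb + ∑ i, δ i • fderiv ℝ (b i) zb = 0 := by
  let P : E → ℝ := fun z => ∑ j, max (A j z) 0 ^ 2 + (∑ l, B l z ^ 2 +
    ∑ i, (max (-a i z) 0 ^ 2 + max (-b i z) 0 ^ 2 + max (a i z) 0 ^ 2 * max (b i z) 0 ^ 2))
  let c : ι ⊕ κ ⊕ μ ⊕ μ → E → ℝ := Sum.elim (fun j z => 2 * max (A j z) 0)
    (Sum.elim (fun l z => 2 * B l z)
      (Sum.elim (fun i z => 2 * max (a i z) 0 * max (b i z) 0 ^ 2 - 2 * max (-a i z) 0)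
        (fun i z => 2 * max (b i z) 0 * max (a i z) 0 ^ 2 - 2 * max (-b i z) 0)))
  let v : ι ⊕ κ ⊕ μ ⊕ μ → E → E →L[ℝ] ℝ := Sum.elim (fun j => fderiv ℝ (A j))
    (Sum.elim (fun l => fderiv ℝ (B l))
      (Sum.elim (fun i => fderiv ℝ (a i)) (fun i => fderiv ℝ (b i))))
  have hsq : ∀ (h : E → ℝ) (h' : E →L[ℝ] ℝ) (z : E), HasFDerivAt h h' z →
      HasFDerivAt (fun z => max (h z) 0 ^ 2) ((2 * max (h z) 0) • h') z := fun h h' z hd =>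
    (hasDerivAt_max_zero_sq (h z)).comp_hasFDerivAt z hd
  have hP : ∀ z, HasFDerivAt P (∑ i, c i z • v i z) z := fun z => by
    have dA := fun j => ((hA j).differentiable one_ne_zero z).hasFDerivAt
    have dB := fun l => ((hB l).differentiable one_ne_zero z).hasFDerivAt
    have da := fun i => ((ha i).differentiable one_ne_zero z).hasFDerivAt
    have db := fun i => ((hb i).differentiable one_ne_zero z).hasFDerivAt
    have hd := (HasFDerivAt.fun_sum (u := Finset.univ) fun j _ => hsq _ _ _ (dA j)).add
      ((HasFDerivAt.fun_sum (u := Finset.univ) fun l _ => (dB l).pow 2).add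
        (HasFDerivAt.fun_sum (u := Finset.univ) fun i _ =>
          ((hsq _ _ _ (da i).neg).add (hsq _ _ _ (db i).neg)).add
            ((hsq _ _ _ (da i)).mul (hsq _ _ _ (db i)))))
    refine hd.congr_fderiv ?_
    simp only [Fintype.sum_sum_type, c, v, Sum.elim_inl, Sum.elim_inr, ← Finset.sum_add_distrib]
    congr 2
    · ext; simp
    · refine Finset.sum_congr rfl fun i _ => ?_
      ext w
      simp
      ring
  have hv : ∀ i, Continuous (v i) := by
    rintro (j | l | i | i)
    exacts [(hA j).continuous_fderiv one_ne_zero, (hB l).continuous_fderiv one_ne_zero,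
      (ha i).continuous_fderiv one_ne_zero, (hb i).continuous_fderiv one_ne_zero]
  have hP0 : ∀ z, 0 ≤ P z := fun z => by positivity
  have hPb : P zb = 0 := by
    have h1 : ∀ i, a i zb ^ 2 * b i zb ^ 2 = 0 := fun i => by
      rw [← mul_pow, (habb i).2.2, zero_pow two_ne_zero]
    simp [P, h1, hAb, hBb, (habb _).1, (habb _).2.1]
  have hPfeas : ∀ z, P z = 0 → (∀ j, A j z ≤ 0) ∧ (∀ l, B l z = 0) ∧
      ∀ i, 0 ≤ a i z ∧ 0 ≤ b i z ∧ a i z * b i z = 0 := fun z hz => by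
    obtain ⟨h1, h2⟩ := (add_eq_zero_iff_of_nonneg (by positivity) (by positivity)).1 hz
    obtain ⟨h2, h3⟩ := (add_eq_zero_iff_of_nonneg (by positivity) (by positivity)).1 h2
    rw [Finset.sum_eq_zero_iff_of_nonneg (fun _ _ => by positivity)] at h1 h2 h3
    refine ⟨fun j => ?_, fun l => ?_, fun i => ?_⟩
    · simpa using h1 j (Finset.mem_univ j)
    · simpa using h2 l (Finset.mem_univ l)
    · obtain ⟨h4, h5⟩ := (add_eq_zero_iff_of_nonneg (by positivity) (by positivity)).1
        (h3 i (Finset.mem_univ i))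
      obtain ⟨h4, h6⟩ := (add_eq_zero_iff_of_nonneg (by positivity) (by positivity)).1 h4
      have h7 : 0 ≤ a i z := by simpa using h4
      have h8 : 0 ≤ b i z := by simpa using h6
      refine ⟨h7, h8, ?_⟩
      rw [max_eq_left h7, max_eq_left h8, ← mul_pow] at h5
      exact pow_eq_zero_iff two_ne_zero |>.1 h5
  obtain ⟨l, z, τ, t, cb, hz, hτ, ht, hne, hlim, hsum⟩ :=
    exists_fritzJohn_multipliers hΦ hP hv hP0 hPb (hmin.mono fun z hz hz0 =>
      let ⟨h1, h2, h3⟩ := hPfeas z hz0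
      hz h1 h2 h3)
  have hcomp : ∀ {h : E → ℝ}, ContDiff ℝ 1 h → Tendsto (fun k => h (z k)) l (𝓝 (h zb)) :=
    fun hh => (hh.continuous.tendsto zb).comp hz
  have hlA : ∀ j, Tendsto (fun k => τ k * (2 * max (A j (z k)) 0)) l (𝓝 (cb (.inl j))) :=
    fun j => hlim (.inl j)
  have hla : ∀ i, Tendsto (fun k => τ k * (2 * max (a i (z k)) 0 * max (b i (z k)) 0 ^ 2 -
      2 * max (-a i (z k)) 0)) l (𝓝 (cb (.inr (.inr (.inl i))))) :=
    fun i => hlim (.inr (.inr (.inl i)))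
  have hlb : ∀ i, Tendsto (fun k => τ k * (2 * max (b i (z k)) 0 * max (a i (z k)) 0 ^ 2 -
      2 * max (-b i (z k)) 0)) l (𝓝 (cb (.inr (.inr (.inr i))))) :=
    fun i => hlim (.inr (.inr (.inr i)))
  have key : ∀ {s r : ℕ → ℝ} {sb rb σ δ : ℝ}, Tendsto s l (𝓝 sb) → Tendsto r l (𝓝 rb) →
      Tendsto (fun k => τ k * (2 * max (s k) 0 * max (r k) 0 ^ 2 - 2 * max (-s k) 0)) l (𝓝 σ) →
      Tendsto (fun k => τ k * (2 * max (r k) 0 * max (s k) 0 ^ 2 - 2 * max (-r k) 0)) l (𝓝 δ) →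
      sb * rb = 0 → 0 < rb → δ = 0 := by
    intro s r sb rb σ δ hs hr hσ hδ hsr hrb
    have hsb : sb = 0 := (mul_eq_zero.1 hsr).resolve_right hrb.ne'
    have h1 := hr.mul hδ
    have h2 := (hs.max (tendsto_const_nhds (x := (0 : ℝ)))).mul hσ
    rw [hsb, max_self, zero_mul] at h2
    have h3 : rb * δ = 0 := by
      refine tendsto_nhds_unique h1 (h2.congr' ?_)
      filter_upwards [hr.eventually (lt_mem_nhds hrb)] with k hk
      linear_combination -(τ k) * mul_max_complementarity_eq (s := s k) hk
    exact (mul_eq_zero.1 h3).resolve_left hrb.ne'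
  refine ⟨t, fun j => cb (.inl j), fun l => cb (.inr (.inl l)), fun i => cb (.inr (.inr (.inl i))),
    fun i => cb (.inr (.inr (.inr i))), ht, ?_, fun j => ⟨?_, ?_⟩, fun i hi => ?_, fun i hi => ?_,
    fun i => ?_, ?_⟩
  · rintro ⟨h0, h1, h2, h3, h4⟩
    refine hne.elim (fun h => h h0) fun h => h ?_
    funext i
    rcases i with j | l | i | i
    exacts [congrFun h1 j, congrFun h2 l, congrFun h3 i, congrFun h4 i]
  · exact ge_of_tendsto' (hlA j) fun k => mul_nonneg (hτ k) (by positivity)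
  · rcases (hAb j).lt_or_eq with hlt | heq
    · have : cb (.inl j) = 0 := by
        refine tendsto_nhds_unique (hlA j) (tendsto_const_nhds.congr' ?_)
        filter_upwards [(hcomp (hA j)).eventually (gt_mem_nhds hlt)] with k hk
        simp [hk.le]
      exact mul_eq_zero_of_left this _
    · rw [heq, mul_zero]
  · exact key (hcomp (hb i)) (hcomp (ha i)) (hlb i) (hla i)
      (by rw [mul_comm]; exact (habb i).2.2) hi
  · exact key (hcomp (ha i)) (hcomp (hb i)) (hla i) (hlb i) (habb i).2.2 hi
  · refine ge_of_tendsto' ((hla i).mul (hlb i)) fun k => ?_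
    rw [mul_mul_mul_comm]
    exact mul_nonneg (mul_nonneg (hτ k) (hτ k)) (two_mul_max_complementarity_nonneg _ _)
  · rw [← hsum]
    simp only [Fintype.sum_sum_type, v, Sum.elim_inl, Sum.elim_inr]
    abel

theorem contDiff_comp_fst_snd_fst {n m q : ℕ} {r : WithTop ℕ∞} {h : Euc n × Euc m → ℝ}
    (hh : ContDiff ℝ r h) :
    ContDiff ℝ r (fun z : Euc n × Euc m × Euc q => h (z.1, z.2.1)) :=
  hh.comp (contDiff_fst.prodMk (contDiff_fst.comp contDiff_snd))

theorem fderiv_comp_fst_snd_fst_apply {n m q : ℕ} {h : Euc n × Euc m → ℝ}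
    (hh : Differentiable ℝ h) (x : Euc n) (y : Euc m) (u : Euc q) (dx : Euc n) (dy : Euc m)
    (du : Euc q) :
    fderiv ℝ (fun z : Euc n × Euc m × Euc q => h (z.1, z.2.1)) (x, y, u) (dx, dy, du) =
      ⟪gradX h x y, dx⟫_ℝ + ⟪gradY h x y, dy⟫_ℝ := by
  have h1 : HasFDerivAt (fun z : Euc n × Euc m × Euc q => (z.1, z.2.1))
      ((ContinuousLinearMap.fst ℝ (Euc n) (Euc m × Euc q)).prod
        ((ContinuousLinearMap.fst ℝ (Euc m) (Euc q)).comp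
          (ContinuousLinearMap.snd ℝ (Euc n) (Euc m × Euc q)))) (x, y, u) :=
    hasFDerivAt_fst.prodMk (hasFDerivAt_fst.comp (x, y, u) hasFDerivAt_snd)
  have h2 := HasFDerivAt.comp (x, y, u)
    (f := fun z : Euc n × Euc m × Euc q => (z.1, z.2.1)) (hh (x, y)).hasFDerivAt h1
  rw [inner_gradX_add_inner_gradY (hh (x, y))]
  exact congrArg (fun A => A (dx, dy, du)) h2.fderiv

theorem eq_zero_of_mem_LambdaYEC {n m q : ℕ} {f : Euc n × Euc m → ℝ}
    {g : Fin q → Euc n × Euc m → ℝ} {x : Euc n} {y : Euc m} {u : Euc q} (hA1 : A1c f g x y u)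
    (hA2 : A2c f g x y u) {bg : (Fin m → ℝ) × (Fin q → ℝ)} (h : bg ∈ LambdaYEC f g x y u 0) :
    bg.1 = 0 ∧ bg.2 = 0 := by
  refine hA1 bg ⟨Prod.ext ?_ ?_, h.2⟩
  · simpa [Prod.fst_sum] using hA2 bg h
  · simpa [Prod.snd_sum] using h.1

/-- Under the qualification conditions, the KKT points close to the reference point are unique:
by symmetry of the Hessian of the Lagrangian, a limit of normalized differences of KKT points
is a multiplier in `Λ_yᵉᶜ`. -/
theorem eventually_eq_of_mem_DSet {n m q : ℕ} {f : Euc n × Euc m → ℝ}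
    {g : Fin q → Euc n × Euc m → ℝ} (hf : ContDiff ℝ 2 f) (hg : ∀ i, ContDiff ℝ 2 (g i))
    {xb : Euc n} {yb : Euc m} {ub : Euc q} (hA1 : A1c f g xb yb ub) (hA2 : A2c f g xb yb ub)
    {x : ℕ → Euc n} {z z' : ℕ → Euc m × Euc q} {l : Ultrafilter ℕ}
    (hx : Tendsto x l (𝓝 xb)) (hz : Tendsto z l (𝓝 (yb, ub))) (hz' : Tendsto z' l (𝓝 (yb, ub)))
    (hD : ∀ k, z k ∈ DSet f g (x k)) (hD' : ∀ k, z' k ∈ DSet f g (x k)) :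
    ∀ᶠ k in l, z k = z' k := by
  by_contra hne
  rw [← Ultrafilter.eventually_not] at hne
  let t : ℕ → ℝ := fun k => ‖z k - z' k‖⁻¹
  have ht : ∀ k, 0 ≤ t k := fun k => inv_nonneg.2 (norm_nonneg _)
  obtain ⟨w, hw1, hw⟩ := (isCompact_sphere (0 : Euc m × Euc q) 1).ultrafilter_le_nhds
    (l.map fun k => t k • (z k - z' k)) (by
      refine tendsto_principal.2 (hne.mono fun k hk => ?_)
      rw [mem_sphere_zero_iff_norm, norm_smul, Real.norm_of_nonneg (ht k)]
      exact inv_mul_cancel₀ (norm_ne_zero_iff.2 (sub_ne_zero.2 hk)))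
  obtain ⟨wy, wu⟩ := w
  replace hw : Tendsto (fun k => t k • (z k - z' k)) l (𝓝 (wy, wu)) := hw
  have hw0 : Tendsto (fun k => t k • ((x k, z k) - (x k, z' k))) l (𝓝 ((0 : Euc n), wy, wu)) := by
    have : Tendsto (fun k => ((0 : Euc n), t k • (z k - z' k))) l (𝓝 ((0 : Euc n), wy, wu)) :=
      tendsto_const_nhds.prodMk_nhds hw
    refine this.congr fun k => ?_
    ext <;> simp
  have hquot : ∀ {h : Euc n × Euc m × Euc q → ℝ}, ContDiff ℝ 1 h →
      Tendsto (fun k => t k * (h (x k, z k) - h (x k, z' k))) l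
        (𝓝 (fderiv ℝ h (xb, yb, ub) (0, wy, wu))) := fun hh =>
    (hh.contDiffAt.hasStrictFDerivAt one_ne_zero).tendsto_smul_sub
      (hx.prodMk_nhds hz) (hx.prodMk_nhds hz') hw0
  have hgz := fun i => (contDiff_comp_fst_snd_fst (q := q) ((hg i).of_le one_le_two))
  have hgd : ∀ i, Tendsto (fun k => t k * (g i (x k, (z k).1) - g i (x k, (z' k).1))) l
      (𝓝 ⟪gradY (g i) xb yb, wy⟫_ℝ) := fun i => by
    have := hquot (hgz i)
    rwa [fderiv_comp_fst_snd_fst_apply ((hg i).differentiable two_ne_zero), inner_zero_right,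
      zero_add] at this
  have hud : ∀ i, Tendsto (fun k => t k * ((z k).2 i - (z' k).2 i)) l (𝓝 (wu i)) := fun i =>
    (((EuclideanSpace.proj i : Euc q →L[ℝ] ℝ).comp
      (ContinuousLinearMap.snd ℝ (Euc m) (Euc q))).continuous.tendsto (wy, wu)).comp hw
      |>.congr fun k => by simp
  have hgl : ∀ i {z : ℕ → Euc m × Euc q}, Tendsto z l (𝓝 (yb, ub)) →
      Tendsto (fun k => g i (x k, (z k).1)) l (𝓝 (g i (xb, yb))) := fun i z hz =>
    ((hgz i).continuous.tendsto (xb, yb, ub)).comp (hx.prodMk_nhds hz)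
  have hul : ∀ i {z : ℕ → Euc m × Euc q}, Tendsto z l (𝓝 (yb, ub)) →
      Tendsto (fun k => (z k).2 i) l (𝓝 (ub i)) := fun i z hz =>
    (((EuclideanSpace.proj i : Euc q →L[ℝ] ℝ).comp
      (ContinuousLinearMap.snd ℝ (Euc m) (Euc q))).continuous.tendsto (yb, ub)).comp hz
  have hL : ∀ k, ⟪gradYL f g xb yb ub k, wy⟫_ℝ + ∑ i, wu i * gradY (g i) xb yb k = 0 := fun k => by
    have := hquot (contDiff_lagGrad hf hg k)
    rw [fderiv_lagGrad_apply hf hg, inner_zero_right, zero_add] at this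
    refine tendsto_nhds_unique this (tendsto_const_nhds.congr fun j => ?_)
    rw [(hD j).1, (hD' j).1, sub_self, mul_zero]
  have hinner : ∀ i, ∑ l, wy l * gradY (g i) xb yb l = ⟪gradY (g i) xb yb, wy⟫_ℝ := fun i => by
    simp [PiLp.inner_apply]
  have hmem : ((wy : Fin m → ℝ), (wu : Fin q → ℝ)) ∈ LambdaYEC f g xb yb ub 0 := by
    refine ⟨?_, fun i hi => ?_, fun i hi => ?_, fun i hi => ?_⟩
    · ext k
      simpa [PiLp.inner_apply, gradYL_symm hf hg xb yb ub k] using hL k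
    · rw [hinner]
      refine tendsto_nhds_unique (hgd i) (tendsto_const_nhds.congr' ?_)
      filter_upwards [(hul i hz).eventually (lt_mem_nhds hi.1),
        (hul i hz').eventually (lt_mem_nhds hi.1)] with k h1 h2
      rw [(mul_eq_zero.1 ((hD k).2 i).2.2).resolve_left h1.ne',
        (mul_eq_zero.1 ((hD' k).2 i).2.2).resolve_left h2.ne', sub_self, mul_zero]
    · refine tendsto_nhds_unique (hud i) (tendsto_const_nhds.congr' ?_)
      filter_upwards [(hgl i hz).eventually (gt_mem_nhds hi.2),
        (hgl i hz').eventually (gt_mem_nhds hi.2)] with k h1 h2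
      rw [(mul_eq_zero.1 ((hD k).2 i).2.2).resolve_right h1.ne,
        (mul_eq_zero.1 ((hD' k).2 i).2.2).resolve_right h2.ne, sub_self, mul_zero]
    · rw [hinner]
      refine ge_of_tendsto' ((hud i).mul (hgd i)) fun k => ?_
      obtain ⟨h1, h2, h3⟩ := (hD k).2 i
      obtain ⟨h1', h2', h3'⟩ := (hD' k).2 i
      rw [mul_mul_mul_comm]
      refine mul_nonneg (mul_nonneg (ht k) (ht k)) ?_
      nlinarith [mul_nonneg h1 (neg_nonneg.2 h2'), mul_nonneg h1' (neg_nonneg.2 h2)]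
  obtain ⟨h1, h2⟩ := eq_zero_of_mem_LambdaYEC hA1 hA2 hmem
  have h1' : wy = 0 := by ext i; exact congrFun h1 i
  have h2' : wu = 0 := by ext i; exact congrFun h2 i
  simp [h1', h2'] at hw1

theorem convexOn_univ_sum_smul {V ι : Type*} [Fintype ι] [AddCommGroup V] [Module ℝ V]
    {h : ι → V → ℝ} (hh : ∀ i, ConvexOn ℝ univ (h i)) {c : ι → ℝ} (hc : ∀ i, 0 ≤ c i) :
    ConvexOn ℝ univ (fun y => ∑ i, c i * h i y) := by
  refine ⟨convex_univ, fun y _ z _ a b ha hb hab => ?_⟩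
  simp only [smul_eq_mul, Finset.mul_sum, ← Finset.sum_add_distrib]
  refine Finset.sum_le_sum fun i _ => ?_
  have := mul_le_mul_of_nonneg_left ((hh i).2 (mem_univ y) (mem_univ z) ha hb hab) (hc i)
  simp only [smul_eq_mul] at this
  linarith

theorem fderiv_norm_sub_sq_self {V : Type*} [NormedAddCommGroup V] [InnerProductSpace ℝ V]
    (y : V) : fderiv ℝ (fun y' => ‖y' - y‖ ^ 2) y = 0 :=
  IsLocalMin.fderiv_eq_zero (Eventually.of_forall fun z => by simp)

theorem contDiff_norm_sub_sq {V : Type*} [NormedAddCommGroup V] [InnerProductSpace ℝ V]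
    (y : V) : ContDiff ℝ 1 (fun y' => ‖y' - y‖ ^ 2) :=
  (contDiff_id.sub contDiff_const).norm_sq ℝ

/-- KKT points of a convex lower-level problem are optimal. -/
theorem mem_lowerS_of_mem_DSet {n m q : ℕ} {f : Euc n × Euc m → ℝ}
    {g : Fin q → Euc n × Euc m → ℝ} (hf : Differentiable ℝ f) (hg : ∀ i, Differentiable ℝ (g i))
    {x : Euc n} (hconvf : ConvexOn ℝ univ (fun y : Euc m => f (x, y)))
    (hconvg : ∀ i, ConvexOn ℝ univ (fun y : Euc m => g i (x, y))) {z : Euc m × Euc q}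
    (hz : z ∈ DSet f g x) : z.1 ∈ lowerS f g x := by
  obtain ⟨hL, hz⟩ := hz
  refine ⟨fun i => (hz i).2.1, fun y hy => ?_⟩
  have hd : DifferentiableAt ℝ (fun y => f (x, y) + ∑ i, z.2 i * g i (x, y)) z.1 := by
    have hp : Differentiable ℝ (fun y : Euc m => (x, y)) := by fun_prop
    exact ((hf.comp hp).add (Differentiable.fun_sum fun i _ =>
      ((hg i).comp hp).const_mul (z.2 i))).differentiableAt
  have hd0 : fderiv ℝ (fun y => f (x, y) + ∑ i, z.2 i * g i (x, y)) z.1 = 0 := by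
    rw [← toDual_gradient]
    exact (congrArg _ hL).trans (map_zero _)
  have h1 := (hconvf.add (convexOn_univ_sum_smul hconvg fun i => (hz i).1)).add_fderiv_le
    hd.hasFDerivAt y
  rw [hd0] at h1
  have h2 : ∑ i, z.2 i * g i (x, z.1) = 0 := Finset.sum_eq_zero fun i _ => (hz i).2.2
  have h3 : ∑ i, z.2 i * g i (x, y) ≤ 0 :=
    Finset.sum_nonpos fun i _ => mul_nonpos_of_nonneg_of_nonpos (hz i).1 (hy i)
  simp only [Pi.add_apply, zero_apply] at h1
  linarith

/-- Optimal points of a convex lower-level problem satisfying the Slater condition are KKT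
points. -/
theorem exists_mem_DSet_of_mem_lowerS {n m q : ℕ} {f : Euc n × Euc m → ℝ}
    {g : Fin q → Euc n × Euc m → ℝ} (hf : ContDiff ℝ 1 f) (hg : ∀ i, ContDiff ℝ 1 (g i))
    {x : Euc n} (hconvg : ∀ i, ConvexOn ℝ univ (fun y : Euc m => g i (x, y)))
    (hslater : ∃ y : Euc m, ∀ i, g i (x, y) < 0) {y : Euc m} (hy : y ∈ lowerS f g x) :
    ∃ u, (y, u) ∈ DSet f g x := by
  have hp : ContDiff ℝ 1 (fun y : Euc m => (x, y)) := contDiff_const.prodMk contDiff_id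
  have hfd : Differentiable ℝ (fun y' => f (x, y')) := (hf.comp hp).differentiable one_ne_zero
  have hgd : ∀ i, Differentiable ℝ (fun y' => g i (x, y')) := fun i =>
    ((hg i).comp hp).differentiable one_ne_zero
  obtain ⟨t, α, β, σ, δ, ht, hne, hα, -, -, -, hsum⟩ :=
    exists_fritzJohn_complementarity (κ := Empty) (μ := Empty) (zb := y)
      (Φ := fun y' => f (x, y') + ‖y' - y‖ ^ 2) (A := fun i y' => g i (x, y'))
      (B := fun l => l.elim) (a := fun l => l.elim) (b := fun l => l.elim)
      ((hf.comp hp).add (contDiff_norm_sub_sq y)) (fun i => (hg i).comp hp)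
      (fun l => l.elim) (fun l => l.elim) (fun l => l.elim) hy.1 (fun l => l.elim)
      (fun l => l.elim) (Eventually.of_forall fun y' h1 _ _ h2 => by
        have h3 := hy.2 y' h1
        have h4 : ‖y' - y‖ ^ 2 ≤ 0 := by
          simp only [sub_self, norm_zero] at h2
          linarith
        simpa [sub_eq_zero] using pow_eq_zero_iff two_ne_zero |>.1
          (le_antisymm h4 (sq_nonneg _)))
  have hadd : fderiv ℝ (fun y' => f (x, y') + ‖y' - y‖ ^ 2) y =
      fderiv ℝ (fun y' => f (x, y')) y := by
    rw [fderiv_fun_add (hfd y) ((contDiff_norm_sub_sq y).differentiable one_ne_zero y),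
      fderiv_norm_sub_sq_self, add_zero]
  simp only [hadd, Finset.univ_eq_empty, Finset.sum_empty, add_zero] at hsum
  have htpos : t ≠ 0 := by
    rintro rfl
    refine hne ⟨rfl, ?_, Subsingleton.elim _ _, Subsingleton.elim _ _, Subsingleton.elim _ _⟩
    obtain ⟨ys, hys⟩ := hslater
    have h1 : ∀ i, α i * fderiv ℝ (fun y' => g i (x, y')) y (ys - y) ≤ α i * g i (x, ys) :=
      fun i => by
        have := mul_le_mul_of_nonneg_left
          ((hconvg i).add_fderiv_le (hgd i y).hasFDerivAt ys) (hα i).1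
        simpa [mul_add, (hα i).2] using this
    have h2 : ∑ i, α i * fderiv ℝ (fun y' => g i (x, y')) y (ys - y) = 0 := by
      simpa using congrArg (fun A => A (ys - y)) hsum
    have h3 : ∀ i ∈ Finset.univ, α i * g i (x, ys) ≤ 0 := fun i _ =>
      mul_nonpos_of_nonneg_of_nonpos (hα i).1 (hys i).le
    have h4 : ∑ i, α i * g i (x, ys) = 0 :=
      le_antisymm (Finset.sum_nonpos h3) (h2 ▸ Finset.sum_le_sum fun i _ => h1 i)
    funext i
    exact (mul_eq_zero.1 ((Finset.sum_eq_zero_iff_of_nonpos h3).1 h4 i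
      (Finset.mem_univ i))).resolve_right (hys i).ne
  refine ⟨WithLp.toLp 2 fun i => t⁻¹ * α i, ?_, fun i => ⟨?_, hy.1 i, ?_⟩⟩
  · ext l
    have h1 := congrArg (fun A => A (EuclideanSpace.single l 1)) hsum
    simp only [add_apply, smul_apply, sum_apply, smul_eq_mul, zero_apply] at h1
    have hgrad : ∀ h : Euc n × Euc m → ℝ, gradY h x y l =
        fderiv ℝ (fun y' => h (x, y')) y (EuclideanSpace.single l 1) := fun h => by
      rw [← inner_gradient_left, EuclideanSpace.inner_single_right]
      simp [gradY]
    rw [lagGrad_apply (hf.differentiable one_ne_zero)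
      fun i => (hg i).differentiable one_ne_zero]
    simp only [hgrad, mul_assoc, ← Finset.mul_sum]
    refine (mul_eq_zero.1 ?_).resolve_left htpos
    rw [mul_add, mul_inv_cancel_left₀ htpos]
    exact h1
  · exact mul_nonneg (inv_nonneg.2 ht) (hα i).1
  · simp [mul_assoc, (hα i).2]

theorem phiP_eq_of_mem_SpSet {n m q : ℕ} {F f : Euc n × Euc m → ℝ}
    {g : Fin q → Euc n × Euc m → ℝ} (hf : ContDiff ℝ 1 f) (hg : ∀ i, ContDiff ℝ 1 (g i))
    {x : Euc n} (hconvf : ConvexOn ℝ univ (fun y : Euc m => f (x, y)))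
    (hconvg : ∀ i, ConvexOn ℝ univ (fun y : Euc m => g i (x, y)))
    (hslater : ∃ y : Euc m, ∀ i, g i (x, y) < 0) {z : Euc m × Euc q}
    (hz : z ∈ SpSet F f g x) : phiP F f g x = F (x, z.1) := by
  refine IsGreatest.csSup_eq ⟨⟨z.1, ?_, rfl⟩, ?_⟩
  · exact mem_lowerS_of_mem_DSet (hf.differentiable one_ne_zero)
      (fun i => (hg i).differentiable one_ne_zero) hconvf hconvg hz.1
  · rintro _ ⟨y, hy, rfl⟩
    obtain ⟨u, hu⟩ := exists_mem_DSet_of_mem_lowerS hf hg hconvg hslater hy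
    exact hz.2 _ hu

/-- A local minimizer of `F` over the KKT points of the lower-level problem is C-stationary. -/
theorem exists_cStationaryWith_of_localMin {n m p q : ℕ} {F f : Euc n × Euc m → ℝ}
    {g : Fin q → Euc n × Euc m → ℝ} {G : Fin p → Euc n → ℝ} (hf : ContDiff ℝ 2 f)
    (hg : ∀ i, ContDiff ℝ 2 (g i)) (hF : ContDiff ℝ 1 F) (hG : ∀ j, ContDiff ℝ 1 (G j))
    {xb : Euc n} (hxb : xb ∈ upperX G) (hreg : UpperLevelRegular G xb) {yb : Euc m} {ub : Euc q}
    (hmem : (yb, ub) ∈ DSet f g xb)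
    (hmin : ∀ᶠ z : Euc n × Euc m × Euc q in 𝓝 (xb, yb, ub),
      z.1 ∈ upperX G → z.2 ∈ DSet f g z.1 → F (xb, yb) ≤ F (z.1, z.2.1))
    (hA1 : A1c f g xb yb ub) (hA2 : A2c f g xb yb ub) :
    ∃ (α : Fin p → ℝ) (β : Fin m → ℝ) (γ : Fin q → ℝ),
      CStationaryWith F f g G xb yb ub α β γ := by
  let Q : Euc n × Euc m × Euc q → ℝ := fun z =>
    ‖z.1 - xb‖ ^ 2 + ‖z.2.1 - yb‖ ^ 2 + ‖z.2.2 - ub‖ ^ 2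
  have hQ : ContDiff ℝ 1 Q :=
    (((contDiff_norm_sub_sq xb).comp contDiff_fst).add
      ((contDiff_norm_sub_sq yb).comp (contDiff_fst.comp contDiff_snd))).add
      ((contDiff_norm_sub_sq ub).comp (contDiff_snd.comp contDiff_snd))
  have hQ0 : fderiv ℝ Q (xb, yb, ub) = 0 :=
    IsLocalMin.fderiv_eq_zero (Eventually.of_forall fun z => by
      have : 0 ≤ Q z := by positivity
      simpa [Q] using this)
  have hF' := contDiff_comp_fst_snd_fst (q := q) hF
  have hG' : ∀ j, ContDiff ℝ 1 (fun z : Euc n × Euc m × Euc q => G j z.1) := fun j =>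
    (hG j).comp contDiff_fst
  have hg' := fun i => contDiff_comp_fst_snd_fst (q := q) ((hg i).of_le one_le_two)
  have hu' : ∀ i, ContDiff ℝ 1 (fun z : Euc n × Euc m × Euc q => z.2.2 i) := fun i => by
    fun_prop
  obtain ⟨t, α, β, σ, δ, ht, hne, hα, hσ, hδ, hσδ, hsum⟩ :=
    exists_fritzJohn_complementarity (zb := (xb, yb, ub)) (hF'.add hQ) hG'
      (contDiff_lagGrad hf hg) hu' (fun i => (hg' i).neg) hxb
      (fun l => by simp [hmem.1])
      (fun i => ⟨(hmem.2 i).1, neg_nonneg.2 (hmem.2 i).2.1, by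
        rw [mul_neg, (hmem.2 i).2.2, neg_zero]⟩)
      (hmin.mono fun z hz h1 h2 h3 h4 => by
        have h5 : F (xb, yb) ≤ F (z.1, z.2.1) := by
          refine hz h1 ⟨by ext l; exact h2 l, fun i => ⟨(h3 i).1, neg_nonneg.1 (h3 i).2.1, ?_⟩⟩
          simpa using (h3 i).2.2
        have h6 : Q z ≤ 0 := by
          have : Q (xb, yb, ub) = 0 := by simp [Q]
          simp only [this] at h4
          linarith
        have h7 := sq_nonneg ‖z.1 - xb‖
        have h8 := sq_nonneg ‖z.2.1 - yb‖
        have h9 := sq_nonneg ‖z.2.2 - ub‖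
        refine Prod.ext ?_ (Prod.ext ?_ ?_) <;>
          rw [← sub_eq_zero, ← norm_eq_zero, ← sq_eq_zero_iff] <;> dsimp [Q] at h6 ⊢ <;>
          linarith)
  have hadd : fderiv ℝ (fun z : Euc n × Euc m × Euc q => F (z.1, z.2.1) + Q z) (xb, yb, ub) =
      fderiv ℝ (fun z : Euc n × Euc m × Euc q => F (z.1, z.2.1)) (xb, yb, ub) := by
    rw [fderiv_fun_add (hF'.differentiable one_ne_zero _) (hQ.differentiable one_ne_zero _), hQ0,
      add_zero]
  have hGapply : ∀ j dx dy du, fderiv ℝ (fun z : Euc n × Euc m × Euc q => G j z.1) (xb, yb, ub)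
      (dx, dy, du) = ⟪gradient (G j) xb, dx⟫_ℝ := fun j dx dy du => by
    have h1 : HasFDerivAt (fun z : Euc n × Euc m × Euc q => G j z.1) _ (xb, yb, ub) :=
      HasFDerivAt.comp (xb, yb, ub) ((hG j).differentiable one_ne_zero xb).hasFDerivAt
        hasFDerivAt_fst
    rw [h1.fderiv, inner_gradient_left]
    rfl
  have huapply : ∀ i dx dy du, fderiv ℝ (fun z : Euc n × Euc m × Euc q => z.2.2 i) (xb, yb, ub)
      (dx, dy, du) = du i := fun i dx dy du => by
    have h1 : HasFDerivAt (fun z : Euc n × Euc m × Euc q => z.2.2 i)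
        ((EuclideanSpace.proj i : Euc q →L[ℝ] ℝ).comp
          ((ContinuousLinearMap.snd ℝ (Euc m) (Euc q)).comp
            (ContinuousLinearMap.snd ℝ (Euc n) (Euc m × Euc q)))) (xb, yb, ub) :=
      ((EuclideanSpace.proj i : Euc q →L[ℝ] ℝ).comp
        ((ContinuousLinearMap.snd ℝ (Euc m) (Euc q)).comp
          (ContinuousLinearMap.snd ℝ (Euc n) (Euc m × Euc q)))).hasFDerivAt
    rw [h1.fderiv]
    rfl
  have hall : ∀ (dx : Euc n) (dy : Euc m) (du : Euc q), t * (⟪gradX F xb yb, dx⟫_ℝ + ⟪gradY F xb yb, dy⟫_ℝ) +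
      ∑ j, α j * ⟪gradient (G j) xb, dx⟫_ℝ +
      ∑ l, β l * (⟪gradXL f g xb yb ub l, dx⟫_ℝ + ⟪gradYL f g xb yb ub l, dy⟫_ℝ +
        ∑ i, du i * gradY (g i) xb yb l) + ∑ i, σ i * du i -
      ∑ i, δ i * (⟪gradX (g i) xb yb, dx⟫_ℝ + ⟪gradY (g i) xb yb, dy⟫_ℝ) = 0 :=
    fun dx dy du => by
    have h1 := congrArg (fun A => A (dx, dy, du)) hsum
    simpa only [hadd, add_apply, smul_apply, sum_apply, smul_eq_mul, zero_apply, hGapply, huapply,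
      fderiv_comp_fst_snd_fst_apply (hF.differentiable one_ne_zero), fderiv_lagGrad_apply hf hg,
      fderiv_fun_neg, neg_apply, mul_neg, Finset.sum_neg_distrib, ← sub_eq_add_neg,
      fderiv_comp_fst_snd_fst_apply ((hg _).differentiable two_ne_zero)] using h1
  have hX : t • gradX F xb yb + (∑ j, α j • gradient (G j) xb) +
      (∑ l, β l • gradXL f g xb yb ub l) + (∑ i, (-δ i) • gradX (g i) xb yb) = 0 := by
    refine ext_inner_right ℝ fun dx => ?_
    simpa [inner_add_left, sum_inner, inner_smul_left, sub_eq_add_neg] using hall dx 0 0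
  have hY : t • gradY F xb yb + (∑ l, β l • gradYL f g xb yb ub l) +
      (∑ i, (-δ i) • gradY (g i) xb yb) = 0 := by
    refine ext_inner_right ℝ fun dy => ?_
    simpa [inner_add_left, sum_inner, inner_smul_left, sub_eq_add_neg] using hall 0 dy 0
  have hU : ∀ i, ∑ l, β l * gradY (g i) xb yb l = -σ i := fun i => by
    have := hall 0 0 (EuclideanSpace.single i 1)
    simp at this
    linarith
  have hν : ∀ i, 0 < ub i ∧ g i (xb, yb) = 0 → ∑ l, β l * gradY (g i) xb yb l = 0 :=
    fun i hi => by rw [hU, hσ i hi.1, neg_zero]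
  have hη : ∀ i, ub i = 0 ∧ g i (xb, yb) < 0 → -δ i = 0 := fun i hi => by
    rw [hδ i (neg_pos.2 hi.2), neg_zero]
  have hθ : ∀ i, 0 ≤ -δ i * ∑ l, β l * gradY (g i) xb yb l := fun i => by
    rw [hU, neg_mul_neg, mul_comm]
    exact hσδ i
  have htpos : 0 < t := by
    refine ht.lt_of_ne' fun h0 => hne ?_
    subst h0
    rw [zero_smul, zero_add] at hX hY
    have hmemΛ : (β, fun i => -δ i) ∈ LambdaYEC f g xb yb ub 0 :=
      ⟨by simpa using hY, hν, hη, fun i _ => hθ i⟩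
    obtain ⟨hβ, hγ⟩ := eq_zero_of_mem_LambdaYEC hA1 hA2 hmemΛ
    have hβ : β = 0 := hβ
    have hγ : ∀ i, δ i = 0 := fun i => neg_eq_zero.1 (congrFun hγ i)
    refine ⟨rfl, hreg α (fun j => (hα j).1) (fun j => (hα j).2) ?_, hβ, ?_, funext hγ⟩
    · simpa [hβ, hγ] using hX
    · funext i
      simpa [hβ] using hU i
  have ht1 : t⁻¹ * t = 1 := inv_mul_cancel₀ htpos.ne'
  have hβsum : ∀ i, ∑ l, t⁻¹ * β l * gradY (g i) xb yb l =
      t⁻¹ * ∑ l, β l * gradY (g i) xb yb l := fun i => by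
    simp only [mul_assoc, Finset.mul_sum]
  refine ⟨fun j => t⁻¹ * α j, fun l => t⁻¹ * β l, fun i => t⁻¹ * -δ i, ?_, ?_, fun j => ⟨?_, hxb j,
    ?_⟩, fun i hi => ?_, fun i hi => ?_, fun i _ => ?_⟩
  · simpa only [smul_add, Finset.smul_sum, smul_smul, ht1, one_smul, smul_zero] using
      congrArg (t⁻¹ • ·) hX
  · simpa only [smul_add, Finset.smul_sum, smul_smul, ht1, one_smul, smul_zero] using
      congrArg (t⁻¹ • ·) hY
  · exact mul_nonneg (inv_nonneg.2 ht) (hα j).1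
  · rw [mul_assoc, (hα j).2, mul_zero]
  · rw [hβsum, hν i hi, mul_zero]
  · simp only [hη i hi, mul_zero]
  · rw [hβsum, mul_mul_mul_comm]
    exact mul_nonneg (mul_self_nonneg _) (hθ i)

/-- a local optimal solution of the pessimistic bilevel problem is
C-stationary under upper-level regularity, inner semicontinuity of `S_p`, and the
qualification conditions `(A₁ᶜ)` and `(A₂ᶜ)`. -/
theorem stmt_16 {n m p q : ℕ} (hn : 0 < n) (hm : 0 < m) (hp : 0 < p) (hq : 0 < q)
    (F f : Euc n × Euc m → ℝ) (g : Fin q → Euc n × Euc m → ℝ) (G : Fin p → Euc n → ℝ)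
    (hf : ContDiff ℝ 2 f) (hg : ∀ i, ContDiff ℝ 2 (g i))
    (hF : ContDiff ℝ 1 F) (hG : ∀ j, ContDiff ℝ 1 (G j))
    (hconvf : ∀ x : Euc n, ConvexOn ℝ Set.univ (fun y : Euc m => f (x, y)))
    (hconvg : ∀ x : Euc n, ∀ i, ConvexOn ℝ Set.univ (fun y : Euc m => g i (x, y)))
    (hslater : ∀ x ∈ upperX G, ∃ y : Euc m, ∀ i, g i (x, y) < 0)
    (hSne : ∀ x ∈ upperX G, (lowerS f g x).Nonempty)
    (xb : Euc n) (hxb : xb ∈ upperX G)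
    (hloc : ∃ U ∈ 𝓝 xb, ∀ x ∈ upperX G ∩ U, phiP F f g xb ≤ phiP F f g x)
    (hreg : UpperLevelRegular G xb)
    (yb : Euc m) (ub : Euc q) (hmem : (yb, ub) ∈ SpSet F f g xb)
    (hinner : InnerSemicontinuousAt (SpSet F f g) xb (yb, ub))
    (hA1 : A1c f g xb yb ub) (hA2 : A2c f g xb yb ub) :
    ∃ (α : Fin p → ℝ) (β : Fin m → ℝ) (γ : Fin q → ℝ),
      CStationaryWith F f g G xb yb ub α β γ := by
  refine exists_cStationaryWith_of_localMin hf hg hF hG hxb hreg hmem.1 ?_ hA1 hA2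
  have hf1 : ContDiff ℝ 1 f := hf.of_le one_le_two
  have hg1 : ∀ i, ContDiff ℝ 1 (g i) := fun i => (hg i).of_le one_le_two
  obtain ⟨U, hU, hloc⟩ := hloc
  by_contra hcon
  rw [Filter.not_eventually] at hcon
  obtain ⟨w, hw, hwP⟩ := exists_seq_forall_of_frequently hcon
  push Not at hwP
  have hx : Tendsto (fun k => (w k).1) atTop (𝓝 xb) := (continuous_fst.tendsto _).comp hw
  have hz : Tendsto (fun k => (w k).2) atTop (𝓝 (yb, ub)) := (continuous_snd.tendsto _).comp hw
  obtain ⟨z, hzS, hzlim⟩ := hinner _ hx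
  have hl := Nat.hyperfilter_le_atTop
  have heq := eventually_eq_of_mem_DSet hf hg hA1 hA2 (hx.mono_left hl) (hz.mono_left hl)
    (hzlim.mono_left hl) (fun k => (hwP k).2.1) (fun k => (hzS k).1)
  obtain ⟨k, hk, hkU⟩ := (heq.and (hl (hx hU))).exists
  have hle := hloc _ ⟨(hwP k).1, hkU⟩
  rw [phiP_eq_of_mem_SpSet hf1 hg1 (hconvf _) (hconvg _) (hslater xb hxb) hmem,
    phiP_eq_of_mem_SpSet hf1 hg1 (hconvf _) (hconvg _) (hslater _ (hwP k).1) (hzS k), ← hk] at hle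
  exact (hwP k).2.2.not_ge hle

end
end

section
/- Consider the instance n = m = 1, q = 2, f(x, y) = x·y, g₁(x, y) = −y, g₂(x, y) = y − 1, and F(x, y) = y (so that ℒ(x, y, (u₁, u₂)) = x − u₁ + u₂). Then for every t ∈ (0, 1] and every x ∈ [0, 1]: sup{ y : there exists (u₁, u₂) ∈ ℝ² with (y, (u₁, u₂)) ∈ 𝒟ᵗ(x) } equals t/x whenever 0 < t ≤ x ≤ 1, and equals 1 whenever 0 ≤ x ≤ t ≤ 1; moreover this supremum is attained. -/
open Filter Topology Metric Set

noncomputable section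

theorem gradient_const_mul_coord_add_const (a b : ℝ) (y : Euc 1) :
    gradient (fun y' : Euc 1 => a * y' 0 + b) y = EuclideanSpace.single 0 a := by
  have h : HasFDerivAt (fun y' : Euc 1 => a * y' 0 + b)
      (a • (EuclideanSpace.proj 0 : Euc 1 →L[ℝ] ℝ)) y :=
    ((EuclideanSpace.proj 0 : Euc 1 →L[ℝ] ℝ).hasFDerivAt.const_mul a).add_const b
  apply HasGradientAt.gradient
  rw [hasGradientAt_iff_hasFDerivAt]
  have hdual : InnerProductSpace.toDual ℝ (Euc 1) (EuclideanSpace.single 0 a) =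
      a • (EuclideanSpace.proj 0 : Euc 1 →L[ℝ] ℝ) := by
    ext v
    simp [EuclideanSpace.inner_single_left]
  rw [hdual]
  exact h

/-- In the example, membership in `𝒟ᵗ(x)` is an explicit system of scalar (in)equalities. -/
theorem mem_DtSet_bilinear_iff (f : Euc 1 × Euc 1 → ℝ) (g : Fin 2 → Euc 1 × Euc 1 → ℝ)
    (hf : f = fun pr => pr.1 0 * pr.2 0)
    (hg0 : g 0 = fun pr => -(pr.2 0))
    (hg1 : g 1 = fun pr => pr.2 0 - 1) (t : ℝ) (x : Euc 1) (p : Euc 1 × Euc 2) :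
    p ∈ DtSet f g t x ↔ x 0 - p.2 0 + p.2 1 = 0 ∧
      (0 ≤ p.2 0 ∧ 0 ≤ p.1 0 ∧ p.2 0 * p.1 0 ≤ t) ∧
      (0 ≤ p.2 1 ∧ p.1 0 ≤ 1 ∧ p.2 1 * (1 - p.1 0) ≤ t) := by
  have hL : lagGrad f g x p.1 p.2 = EuclideanSpace.single 0 (x 0 - p.2 0 + p.2 1) := by
    rw [← gradient_const_mul_coord_add_const _ (-(p.2 1)) p.1]
    unfold lagGrad gradY
    congr 1
    funext y
    simp only [Fin.sum_univ_two, hf, hg0, hg1]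
    ring
  have hneg : -(p.2 1 * (p.1 0 - 1)) = p.2 1 * (1 - p.1 0) := by ring
  simp only [DtSet, Set.mem_ofPred_eq, hL, Fin.forall_fin_two, hg0, hg1, hneg]
  simp

/-- the illustrative example `f(x,y) = x·y`, `g₁ = -y`, `g₂ = y - 1`,
`F(x,y) = y`: the value of the relaxed inner maximization is `t/x` for `0 < t ≤ x ≤ 1`
and `1` for `0 ≤ x ≤ t ≤ 1`, and it is attained. -/
theorem stmt_17 (f : Euc 1 × Euc 1 → ℝ) (g : Fin 2 → Euc 1 × Euc 1 → ℝ)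
    (hf : f = fun pr => pr.1 0 * pr.2 0)
    (hg0 : g 0 = fun pr => -(pr.2 0))
    (hg1 : g 1 = fun pr => pr.2 0 - 1) :
    ∀ t : ℝ, 0 < t → t ≤ 1 → ∀ x : Euc 1, 0 ≤ x 0 → x 0 ≤ 1 →
      (t ≤ x 0 →
        IsGreatest ((fun z : Euc 1 × Euc 2 => z.1 0) '' DtSet f g t x) (t / x 0)) ∧
      (x 0 ≤ t →
        IsGreatest ((fun z : Euc 1 × Euc 2 => z.1 0) '' DtSet f g t x) 1) := by
  intro t ht ht1 x hx0 hx1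
  have attained : ∀ y : ℝ, 0 ≤ y → y ≤ 1 → x 0 * y ≤ t →
      y ∈ (fun z : Euc 1 × Euc 2 => z.1 0) '' DtSet f g t x := by
    intro y hy0 hy1 hxy
    refine ⟨(!₂[y], !₂[x 0, 0]), ?_, by simp⟩
    rw [mem_DtSet_bilinear_iff f g hf hg0 hg1]
    simp [hx0, hy0, hy1, hxy, ht.le]
  constructor
  · intro htx
    have hx : 0 < x 0 := ht.trans_le htx
    refine ⟨attained _ (by positivity) ((div_le_one hx).2 htx)
      (mul_div_cancel₀ t hx.ne').le, ?_⟩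
    rintro _ ⟨p, hp, rfl⟩
    obtain ⟨hL, ⟨-, hy0, hu0⟩, hu1, -, -⟩ :=
      (mem_DtSet_bilinear_iff f g hf hg0 hg1 t x p).1 hp
    rw [le_div_iff₀ hx]
    nlinarith [mul_nonneg hu1 hy0]
  · intro hxt
    refine ⟨attained 1 zero_le_one le_rfl (by simpa using hxt), ?_⟩
    rintro _ ⟨p, hp, rfl⟩
    exact ((mem_DtSet_bilinear_iff f g hf hg0 hg1 t x p).1 hp).2.2.2.1

end
end
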